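/- arXiv:2411.06341 — 5 statements merged into one kernel-verified Lean document; each statement's English description precedes it below -/
import Mathlib

section
/- Let X and Y be real Banach spaces, let T : (0,∞) → L(Y,X) be a family of bounded linear operators such that for every y ∈ Y the map τ ↦ T(τ)y is continuous on (0,∞) and ‖T(τ)‖ ≤ k(1 + τ^{−a})e^{−λτ} for all τ > 0 (with constants k > 0, λ > 0, a ∈ (0,1)), and let B : X × X → Y be a continuous bilinear map with ‖B(x,x')‖_Y ≤ c‖x‖_X‖x'‖_X. Suppose ω = ω₁ + ω₂ and f = f₁ + f₂, where ω₁ ∈ C_b(ℝ,X) and f₁ ∈ C_b(ℝ,Y) are jointly almost periodic (for every ε > 0 there exists l > 0 such that every interval of length l contains a number T₀ with sup_{t∈ℝ}(‖ω₁(t+T₀)−ω₁(t)‖_X + ‖f₁(t+T₀)−f₁(t)‖_Y) < ε), ω₂ ∈ PAP₀(ℝ,X), and f₂ ∈ PAP₀(ℝ,Y). Then the function u(t) = ∫_{−∞}^t T(t−s)(B(ω(s),ω(s)) + f(s)) ds is pseudo almost periodic, i.e. u = u₁ + u₂ with u₁ : ℝ → X almost periodic and u₂ ∈ PAP₀(ℝ,X).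 -/
open MeasureTheory Set Filter

noncomputable section

/-- A bounded continuous function `h : ℝ → Z` is almost periodic. -/
def IsAP {Z : Type*} [NormedAddCommGroup Z] (h : ℝ → Z) : Prop :=
  Continuous h ∧ (∃ C : ℝ, ∀ t : ℝ, ‖h t‖ ≤ C) ∧
    ∀ ε > (0:ℝ), ∃ l > (0:ℝ), ∀ α : ℝ, ∃ T₀ ∈ Set.Icc α (α + l),
      ∀ t : ℝ, ‖h (t + T₀) - h t‖ < ε

/-- A bounded continuous function `φ : ℝ → Z` with vanishing mean value. -/
def IsPAP0 {Z : Type*} [NormedAddCommGroup Z] (φ : ℝ → Z) : Prop :=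
  Continuous φ ∧ (∃ C : ℝ, ∀ t : ℝ, ‖φ t‖ ≤ C) ∧
    Tendsto (fun L : ℝ => (1 / (2 * L)) * ∫ t in (-L)..L, ‖φ t‖) atTop (nhds 0)

section Helpers

variable {X Y : Type*} [NormedAddCommGroup X] [NormedSpace ℝ X]
    [NormedAddCommGroup Y] [NormedSpace ℝ Y]

/-- The kernel majorant is integrable. -/
lemma kernel_integrable (k lam a : ℝ) (hlam : 0 < lam) (ha : a ∈ Ioo (0:ℝ) 1) :
    IntegrableOn (fun τ : ℝ => k * (1 + τ ^ (-a)) * Real.exp (-lam * τ)) (Ioi 0) := by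
  have h1 := integrableOn_rpow_mul_exp_neg_mul_rpow (p := 1) (s := -a) (b := lam)
    (by linarith [ha.2]) one_pos hlam
  have h2 := integrableOn_rpow_mul_exp_neg_mul_rpow (p := 1) (s := 0) (b := lam)
    (by norm_num) one_pos hlam
  have h3 := (h2.add h1).const_mul k
  refine h3.congr (Eventually.of_forall fun τ => ?_)
  simp only [Pi.add_apply, Real.rpow_one, Real.rpow_zero]
  ring

lemma kernel_continuousOn (k lam a : ℝ) :
    ContinuousOn (fun τ : ℝ => k * (1 + τ ^ (-a)) * Real.exp (-lam * τ)) (Ioi 0) := by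
  have h : ContinuousOn (fun τ : ℝ => τ ^ (-a)) (Ioi 0) := by
    intro x hx
    exact (Real.continuousAt_rpow_const x _ (Or.inl (ne_of_gt hx))).continuousWithinAt
  have h2 : ContinuousOn (fun τ : ℝ => Real.exp (-lam * τ)) (Ioi 0) := by fun_prop
  exact (continuousOn_const.mul (continuousOn_const.add h)).mul h2

lemma conv_continuousOn (T : ℝ → Y →L[ℝ] X) (M : ℝ → ℝ)
    (hTcont : ∀ y : Y, ContinuousOn (fun τ : ℝ => T τ y) (Ioi 0))
    (hMc : ContinuousOn M (Ioi 0)) (hT : ∀ τ, 0 < τ → ‖T τ‖ ≤ M τ)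
    (g : ℝ → Y) (hg : Continuous g) (t : ℝ) :
    ContinuousOn (fun τ => T τ (g (t - τ))) (Ioi 0) := by
  intro x hx
  have hy := hTcont (g (t - x)) x hx
  have hM := hMc x hx
  unfold ContinuousWithinAt at *
  have hd : Tendsto (fun τ => M τ * ‖g (t - τ) - g (t - x)‖) (nhdsWithin x (Ioi 0)) (nhds 0) := by
    have hc : Continuous fun τ => ‖g (t - τ) - g (t - x)‖ := by fun_prop
    have := hM.mul ((hc.tendsto x).mono_left (nhdsWithin_le_nhds (s := Ioi 0)))
    simpa using this
  have hz : Tendsto (fun τ => T τ (g (t - τ) - g (t - x))) (nhdsWithin x (Ioi 0)) (nhds 0) := by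
    refine squeeze_zero_norm' ?_ hd
    filter_upwards [self_mem_nhdsWithin] with τ hτ
    exact (T τ).le_of_opNorm_le (hT τ hτ) _
  have := hz.add hy
  simpa using this

lemma conv_bound (T : ℝ → Y →L[ℝ] X) (M : ℝ → ℝ)
    (hT : ∀ τ, 0 < τ → ‖T τ‖ ≤ M τ)
    (g : ℝ → Y) (C : ℝ) (hC : ∀ t, ‖g t‖ ≤ C) (t τ : ℝ) (hτ : 0 < τ) :
    ‖T τ (g (t - τ))‖ ≤ M τ * C :=
  ((T τ).le_of_opNorm_le (hT τ hτ) _).trans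
    (mul_le_mul_of_nonneg_left (hC _) ((norm_nonneg _).trans (hT τ hτ)))

lemma conv_integrable (T : ℝ → Y →L[ℝ] X) (M : ℝ → ℝ)
    (hTcont : ∀ y : Y, ContinuousOn (fun τ : ℝ => T τ y) (Ioi 0))
    (hMc : ContinuousOn M (Ioi 0)) (hMi : IntegrableOn M (Ioi 0))
    (hT : ∀ τ, 0 < τ → ‖T τ‖ ≤ M τ)
    (g : ℝ → Y) (hg : Continuous g) (C : ℝ) (hC : ∀ t, ‖g t‖ ≤ C) (t : ℝ) :
    IntegrableOn (fun τ => T τ (g (t - τ))) (Ioi 0) := by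
  refine Integrable.mono' (hMi.mul_const C)
    ((conv_continuousOn T M hTcont hMc hT g hg t).aestronglyMeasurable measurableSet_Ioi) ?_
  filter_upwards [ae_restrict_mem measurableSet_Ioi] with τ hτ
  exact conv_bound T M hT g C hC t τ hτ

lemma conv_continuous (T : ℝ → Y →L[ℝ] X) (M : ℝ → ℝ)
    (hTcont : ∀ y : Y, ContinuousOn (fun τ : ℝ => T τ y) (Ioi 0))
    (hMc : ContinuousOn M (Ioi 0)) (hMi : IntegrableOn M (Ioi 0))
    (hT : ∀ τ, 0 < τ → ‖T τ‖ ≤ M τ)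
    (g : ℝ → Y) (hg : Continuous g) (C : ℝ) (hC : ∀ t, ‖g t‖ ≤ C) :
    Continuous (fun t => ∫ τ in Ioi (0:ℝ), T τ (g (t - τ))) := by
  refine continuous_of_dominated (bound := fun τ => M τ * C) (fun t =>
    (conv_integrable T M hTcont hMc hMi hT g hg C hC t).aestronglyMeasurable) ?_
    (hMi.mul_const C) ?_
  · intro t
    filter_upwards [ae_restrict_mem measurableSet_Ioi] with τ hτ
    exact conv_bound T M hT g C hC t τ hτ
  · exact Eventually.of_forall fun τ => by fun_prop

lemma conv_norm_le (T : ℝ → Y →L[ℝ] X) (M : ℝ → ℝ)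
    (hMi : IntegrableOn M (Ioi 0))
    (hT : ∀ τ, 0 < τ → ‖T τ‖ ≤ M τ)
    (g : ℝ → Y) (C : ℝ) (hC : ∀ t, ‖g t‖ ≤ C) (t : ℝ) :
    ‖∫ τ in Ioi (0:ℝ), T τ (g (t - τ))‖ ≤ (∫ τ in Ioi (0:ℝ), M τ) * C := by
  rw [← integral_mul_const]
  refine norm_integral_le_of_norm_le (hMi.mul_const C) ?_
  filter_upwards [ae_restrict_mem measurableSet_Ioi] with τ hτ
  exact conv_bound T M hT g C hC t τ hτ

lemma conv_AP (T : ℝ → Y →L[ℝ] X) (M : ℝ → ℝ)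
    (hTcont : ∀ y : Y, ContinuousOn (fun τ : ℝ => T τ y) (Ioi 0))
    (hMc : ContinuousOn M (Ioi 0)) (hMi : IntegrableOn M (Ioi 0))
    (hT : ∀ τ, 0 < τ → ‖T τ‖ ≤ M τ) (g : ℝ → Y) (hg : IsAP g) :
    IsAP (fun t => ∫ τ in Ioi (0:ℝ), T τ (g (t - τ))) := by
  obtain ⟨hgc, ⟨C, hC⟩, hap⟩ := hg
  refine ⟨conv_continuous T M hTcont hMc hMi hT g hgc C hC,
    ⟨_, conv_norm_le T M hMi hT g C hC⟩, fun ε hε => ?_⟩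
  have hM0 : 0 ≤ ∫ τ in Ioi (0:ℝ), M τ :=
    setIntegral_nonneg measurableSet_Ioi fun τ hτ => (norm_nonneg _).trans (hT τ hτ)
  set I := ∫ τ in Ioi (0:ℝ), M τ
  obtain ⟨l, hl, h⟩ := hap (ε / (I + 1)) (by positivity)
  refine ⟨l, hl, fun α => ?_⟩
  obtain ⟨T₀, hT₀, h'⟩ := h α
  refine ⟨T₀, hT₀, fun t => ?_⟩
  have e : (∫ τ in Ioi (0:ℝ), T τ (g (t + T₀ - τ))) - ∫ τ in Ioi (0:ℝ), T τ (g (t - τ))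
      = ∫ τ in Ioi (0:ℝ), T τ ((fun s => g (s + T₀) - g s) (t - τ)) := by
    rw [← integral_sub (conv_integrable T M hTcont hMc hMi hT g hgc C hC _)
      (conv_integrable T M hTcont hMc hMi hT g hgc C hC _)]
    congr 1
    ext τ
    simp only [map_sub]
    rw [show t + T₀ - τ = t - τ + T₀ by ring]
  simp only [e]
  have := conv_norm_le T M hMi hT (fun s => g (s + T₀) - g s) (ε / (I + 1))
    (fun s => (h' s).le) t
  refine this.trans_lt ?_
  change I * (ε / (I + 1)) < ε
  rw [mul_div_assoc', div_lt_iff₀ (by positivity)]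
  nlinarith

/-- Translates of ergodic functions are ergodic. -/
lemma shift_mean (φ : ℝ → ℝ) (hφ : Continuous φ) (C : ℝ) (h0 : ∀ t, 0 ≤ φ t) (hC : ∀ t, φ t ≤ C)
    (hm : Tendsto (fun L : ℝ => (1 / (2 * L)) * ∫ t in (-L)..L, φ t) atTop (nhds 0))
    (τ : ℝ) (hτ : 0 < τ) :
    Tendsto (fun L : ℝ => (1 / (2 * L)) * ∫ t in (-L)..L, φ (t - τ)) atTop (nhds 0) := by
  have h2 : Tendsto (fun L : ℝ => (1 / (2 * L)) * (C * τ)) atTop (nhds 0) := by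
    have : Tendsto (fun L : ℝ => 1 / (2 * L)) atTop (nhds 0) := by
      simp only [one_div]
      exact tendsto_inv_atTop_zero.comp (tendsto_id.const_mul_atTop (by norm_num))
    simpa using this.mul_const (C * τ)
  have h3 := hm.add h2
  rw [add_zero] at h3
  have hi : ∀ a b, IntervalIntegrable φ volume a b := fun a b => hφ.intervalIntegrable a b
  refine squeeze_zero' ?_ ?_ h3
  · filter_upwards [eventually_gt_atTop 0] with L hL
    exact mul_nonneg (by positivity)
      (intervalIntegral.integral_nonneg (by linarith) fun t _ => h0 _)
  · filter_upwards [eventually_gt_atTop 0] with L hL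
    rw [← mul_add]
    refine mul_le_mul_of_nonneg_left ?_ (by positivity)
    rw [intervalIntegral.integral_comp_sub_right (fun t => φ t) τ]
    have e1 := intervalIntegral.integral_add_adjacent_intervals (hi (-L - τ) (-L)) (hi (-L) (L - τ))
    have e2 := intervalIntegral.integral_add_adjacent_intervals (hi (-L) (L - τ)) (hi (L - τ) L)
    have e3 : 0 ≤ ∫ t in (L - τ)..L, φ t :=
      intervalIntegral.integral_nonneg (by linarith) fun t _ => h0 _
    have e4 : ∫ t in (-L - τ)..(-L), φ t ≤ ∫ t in (-L - τ)..(-L), C :=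
      intervalIntegral.integral_mono_on (by linarith) (hi _ _) (by simp) fun t _ => hC _
    rw [intervalIntegral.integral_const, smul_eq_mul] at e4
    have : (-L - (-L - τ)) * C = C * τ := by ring
    linarith

lemma mean_mono (φ ψ : ℝ → ℝ) (hφ : Continuous φ) (hψ : Continuous ψ)
    (h0 : ∀ t, 0 ≤ φ t) (hle : ∀ t, φ t ≤ ψ t)
    (hm : Tendsto (fun L : ℝ => (1 / (2 * L)) * ∫ t in (-L)..L, ψ t) atTop (nhds 0)) :
    Tendsto (fun L : ℝ => (1 / (2 * L)) * ∫ t in (-L)..L, φ t) atTop (nhds 0) := by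
  refine squeeze_zero' ?_ ?_ hm
  · filter_upwards [eventually_gt_atTop 0] with L hL
    exact mul_nonneg (by positivity)
      (intervalIntegral.integral_nonneg (by linarith) fun t _ => h0 _)
  · filter_upwards [eventually_gt_atTop 0] with L hL
    exact mul_le_mul_of_nonneg_left
      (intervalIntegral.integral_mono_on (by linarith) (hφ.intervalIntegrable _ _)
        (hψ.intervalIntegrable _ _) fun t _ => hle t) (by positivity)

lemma conv_PAP0 (T : ℝ → Y →L[ℝ] X) (M : ℝ → ℝ)
    (hTcont : ∀ y : Y, ContinuousOn (fun τ : ℝ => T τ y) (Ioi 0))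
    (hMc : ContinuousOn M (Ioi 0)) (hMi : IntegrableOn M (Ioi 0))
    (hT : ∀ τ, 0 < τ → ‖T τ‖ ≤ M τ) (g : ℝ → Y) (hg : IsPAP0 g) :
    IsPAP0 (fun t => ∫ τ in Ioi (0:ℝ), T τ (g (t - τ))) := by
  obtain ⟨hgc, ⟨C, hC⟩, hm⟩ := hg
  have hcont := conv_continuous T M hTcont hMc hMi hT g hgc C hC
  refine ⟨hcont, ⟨_, conv_norm_le T M hMi hT g C hC⟩, ?_⟩
  have hM0 : ∀ τ, 0 < τ → 0 ≤ M τ := fun τ hτ => (norm_nonneg _).trans (hT τ hτ)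
  have hC0 : 0 ≤ C := (norm_nonneg _).trans (hC 0)
  -- the majorant after Fubini
  have hdom : Tendsto (fun L : ℝ => ∫ τ in Ioi (0:ℝ),
      M τ * ((1 / (2 * L)) * ∫ t in (-L)..L, ‖g (t - τ)‖)) atTop (nhds 0) := by
    have hz : (∫ τ in Ioi (0:ℝ), (0:ℝ)) = 0 := by simp
    suffices h : Tendsto (fun L : ℝ => ∫ τ in Ioi (0:ℝ),
        M τ * ((1 / (2 * L)) * ∫ t in (-L)..L, ‖g (t - τ)‖)) atTop
        (nhds (∫ τ in Ioi (0:ℝ), (0:ℝ))) by rwa [hz] at h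
    refine tendsto_integral_filter_of_dominated_convergence (fun τ => M τ * C) ?_ ?_
      (hMi.mul_const C) ?_
    · refine Eventually.of_forall fun L => hMi.aestronglyMeasurable.mul ?_
      have : Continuous fun τ => ∫ t in (-L)..L, ‖g (t - τ)‖ :=
        intervalIntegral.continuous_parametric_intervalIntegral_of_continuous' (by
          simp only [Function.uncurry_def]; fun_prop) _ _
      exact (continuous_const.mul this).aestronglyMeasurable
    · filter_upwards [eventually_gt_atTop 0] with L hL
      filter_upwards [ae_restrict_mem measurableSet_Ioi] with τ hτ
      have hn : 0 ≤ ∫ t in (-L)..L, ‖g (t - τ)‖ :=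
        intervalIntegral.integral_nonneg (by linarith) fun t _ => norm_nonneg _
      rw [Real.norm_of_nonneg (mul_nonneg (hM0 τ hτ) (mul_nonneg (by positivity) hn))]
      refine mul_le_mul_of_nonneg_left ?_ (hM0 τ hτ)
      have hle : ∫ t in (-L)..L, ‖g (t - τ)‖ ≤ ∫ t in (-L)..L, C :=
        intervalIntegral.integral_mono_on (by linarith)
          ((by fun_prop : Continuous fun t => ‖g (t - τ)‖).intervalIntegrable _ _)
          (by simp) fun t _ => hC _
      rw [intervalIntegral.integral_const, smul_eq_mul] at hle
      rw [one_div, inv_mul_le_iff₀ (by positivity)]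
      linarith
    · filter_upwards [ae_restrict_mem measurableSet_Ioi] with τ hτ
      have := (shift_mean (fun t => ‖g t‖) hgc.norm C (fun _ => norm_nonneg _) hC hm τ hτ).const_mul
        (M τ)
      simpa using this
  refine squeeze_zero' ?_ ?_ hdom
  · filter_upwards [eventually_gt_atTop 0] with L hL
    exact mul_nonneg (by positivity)
      (intervalIntegral.integral_nonneg (by linarith) fun t _ => norm_nonneg _)
  · filter_upwards [eventually_gt_atTop 0] with L hL
    have hLL : -L ≤ L := by linarith
    have hprod : Integrable (Function.uncurry fun t τ : ℝ => M τ * ‖g (t - τ)‖)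
        ((volume.restrict (Ioc (-L) L)).prod (volume.restrict (Ioi 0))) := by
      have hCi : Integrable (fun _ : ℝ => C) (volume.restrict (Ioc (-L) L)) := by
        exact integrable_const C
      have hb := hCi.mul_prod hMi
      refine hb.mono' ?_ ?_
      · simp only [Function.uncurry_def]
        have hc : Continuous fun z : ℝ × ℝ => ‖g (z.1 - z.2)‖ := by fun_prop
        exact (hMi.aestronglyMeasurable.comp_snd).mul hc.aestronglyMeasurable
      · rw [Measure.prod_restrict]
        filter_upwards [ae_restrict_mem (measurableSet_Ioc.prod measurableSet_Ioi)] with z hz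
        have h2 : 0 ≤ M z.2 := hM0 _ hz.2
        simp only [Function.uncurry_def]
        rw [Real.norm_of_nonneg (mul_nonneg h2 (norm_nonneg _)), mul_comm]
        exact mul_le_mul_of_nonneg_right (hC _) h2
    have hsw := integral_integral_swap hprod
    have hleft := hprod.integral_prod_left
    have key : ∫ t in (-L)..L, ‖∫ τ in Ioi (0:ℝ), T τ (g (t - τ))‖
        ≤ ∫ τ in Ioi (0:ℝ), M τ * ∫ t in (-L)..L, ‖g (t - τ)‖ := by
      simp only [intervalIntegral.integral_of_le hLL]
      simp only [← integral_const_mul]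
      rw [← hsw]
      refine integral_mono ?_ hleft fun t => ?_
      · exact (hcont.norm.intervalIntegrable (-L) L).1
      · refine norm_integral_le_of_norm_le ?_ ?_
        · refine (hMi.mul_const C).mono' (hMi.aestronglyMeasurable.mul
            (by fun_prop : Continuous fun τ => ‖g (t - τ)‖).aestronglyMeasurable) ?_
          filter_upwards [ae_restrict_mem measurableSet_Ioi] with τ hτ
          rw [Real.norm_of_nonneg (mul_nonneg (hM0 τ hτ) (norm_nonneg _))]
          exact mul_le_mul_of_nonneg_left (hC _) (hM0 τ hτ)
        · filter_upwards [ae_restrict_mem measurableSet_Ioi] with τ hτ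
          exact (T τ).le_of_opNorm_le (hT τ hτ) _
    refine (mul_le_mul_of_nonneg_left key (by positivity)).trans_eq ?_
    rw [← integral_const_mul]
    congr 1
    ext τ
    ring

lemma conv_change (T : ℝ → Y →L[ℝ] X) (g : ℝ → Y) (t : ℝ) :
    ∫ s in Iio t, T (t - s) (g s) = ∫ τ in Ioi (0:ℝ), T τ (g (t - τ)) := by
  rw [← integral_indicator measurableSet_Iio, ← integral_indicator measurableSet_Ioi,
    ← integral_sub_left_eq_self _ volume t]
  congr 1
  ext s
  by_cases h : 0 < s <;> simp [indicator, h]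

end Helpers

theorem stmt1
    {X Y : Type*} [NormedAddCommGroup X] [NormedSpace ℝ X] [CompleteSpace X]
    [NormedAddCommGroup Y] [NormedSpace ℝ Y]
    (T : ℝ → Y →L[ℝ] X)
    (hTcont : ∀ y : Y, ContinuousOn (fun τ : ℝ => T τ y) (Ioi 0))
    (k lam a c : ℝ) (hk : 0 < k) (hlam : 0 < lam) (ha : a ∈ Ioo (0:ℝ) 1)
    (hT : ∀ τ : ℝ, 0 < τ → ‖T τ‖ ≤ k * (1 + τ ^ (-a)) * Real.exp (-lam * τ))
    (B : X →L[ℝ] X →L[ℝ] Y)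
    (hB : ∀ x x' : X, ‖B x x'‖ ≤ c * ‖x‖ * ‖x'‖)
    (ω₁ : BoundedContinuousFunction ℝ X) (f₁ : BoundedContinuousFunction ℝ Y)
    (hAP : ∀ ε > (0:ℝ), ∃ l > (0:ℝ), ∀ α : ℝ, ∃ T₀ ∈ Set.Icc α (α + l),
      ∀ t : ℝ, ‖ω₁ (t + T₀) - ω₁ t‖ + ‖f₁ (t + T₀) - f₁ t‖ < ε)
    (ω₂ : ℝ → X) (hω₂ : IsPAP0 ω₂) (f₂ : ℝ → Y) (hf₂ : IsPAP0 f₂) :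
    ∃ u₁ u₂ : ℝ → X, IsAP u₁ ∧ IsPAP0 u₂ ∧
      ∀ t : ℝ, (∫ s in Iio t, T (t - s)
          (B (ω₁ s + ω₂ s) (ω₁ s + ω₂ s) + (f₁ s + f₂ s))) = u₁ t + u₂ t := by
  set M : ℝ → ℝ := fun τ => k * (1 + τ ^ (-a)) * Real.exp (-lam * τ) with hMdef
  have hMi : IntegrableOn M (Ioi 0) := kernel_integrable k lam a hlam ha
  have hMc : ContinuousOn M (Ioi 0) := kernel_continuousOn k lam a
  obtain ⟨hω₂c, ⟨C₂, hC₂⟩, hω₂m⟩ := hω₂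
  obtain ⟨hf₂c, ⟨D₂, hD₂⟩, hf₂m⟩ := hf₂
  have hω₁c : Continuous ω₁ := ω₁.continuous
  have hf₁c : Continuous f₁ := f₁.continuous
  have hC₁ : ∀ t, ‖ω₁ t‖ ≤ ‖ω₁‖ := ω₁.norm_coe_le_norm
  have hC20 : 0 ≤ C₂ := (norm_nonneg _).trans (hC₂ 0)
  have hBB : ∀ x y : X, ‖B x y‖ ≤ ‖B‖ * ‖x‖ * ‖y‖ := B.le_opNorm₂
  set g₁ : ℝ → Y := fun s => B (ω₁ s) (ω₁ s) + f₁ s with hg₁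
  set g₂ : ℝ → Y := fun s => B (ω₁ s) (ω₂ s) + B (ω₂ s) (ω₁ s + ω₂ s) + f₂ s with hg₂
  have hg₁c : Continuous g₁ := by fun_prop
  have hg₂c : Continuous g₂ := by fun_prop
  have hAPg : IsAP g₁ := by
    refine ⟨hg₁c, ⟨‖B‖ * ‖ω₁‖ * ‖ω₁‖ + ‖f₁‖, fun t => ?_⟩, fun ε hε => ?_⟩
    · refine (norm_add_le _ _).trans (add_le_add ((hBB _ _).trans ?_) (f₁.norm_coe_le_norm t))
      gcongr <;> exact hC₁ t
    · set K : ℝ := 2 * ‖B‖ * ‖ω₁‖ + 1 with hK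
      have hK0 : 0 < K := by positivity
      obtain ⟨l, hl, h⟩ := hAP (ε / K) (by positivity)
      refine ⟨l, hl, fun α => ?_⟩
      obtain ⟨T₀, hT₀, h'⟩ := h α
      refine ⟨T₀, hT₀, fun t => ?_⟩
      have h1 := h' t
      rw [lt_div_iff₀ hK0] at h1
      refine lt_of_le_of_lt ?_ h1
      have e : g₁ (t + T₀) - g₁ t = B (ω₁ (t + T₀)) (ω₁ (t + T₀) - ω₁ t)
          + B (ω₁ (t + T₀) - ω₁ t) (ω₁ t) + (f₁ (t + T₀) - f₁ t) := by
        simp only [hg₁, map_sub, sub_apply]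
        abel
      rw [e]
      have n1 : ‖B (ω₁ (t + T₀)) (ω₁ (t + T₀) - ω₁ t)‖ ≤ ‖B‖ * ‖ω₁‖ * ‖ω₁ (t + T₀) - ω₁ t‖ := by
        refine (hBB _ _).trans ?_
        gcongr
        exact hC₁ _
      have n2 : ‖B (ω₁ (t + T₀) - ω₁ t) (ω₁ t)‖ ≤ ‖B‖ * ‖ω₁ (t + T₀) - ω₁ t‖ * ‖ω₁‖ := by
        refine (hBB _ _).trans ?_
        gcongr
        exact hC₁ _
      have n3 := norm_add₃_le (a := B (ω₁ (t + T₀)) (ω₁ (t + T₀) - ω₁ t))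
        (b := B (ω₁ (t + T₀) - ω₁ t) (ω₁ t)) (c := f₁ (t + T₀) - f₁ t)
      have n4 : 0 ≤ 2 * ‖B‖ * ‖ω₁‖ * ‖f₁ (t + T₀) - f₁ t‖ := by positivity
      have n5 : 0 ≤ ‖ω₁ (t + T₀) - ω₁ t‖ := norm_nonneg _
      rw [hK]
      linarith
  have hbd : ∀ t, ‖g₂ t‖ ≤ ‖B‖ * (2 * ‖ω₁‖ + C₂) * ‖ω₂ t‖ + ‖f₂ t‖ := by
    intro t
    have n1 : ‖B (ω₁ t) (ω₂ t)‖ ≤ ‖B‖ * ‖ω₁‖ * ‖ω₂ t‖ := by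
      refine (hBB _ _).trans ?_
      gcongr
      exact hC₁ _
    have n2 : ‖B (ω₂ t) (ω₁ t + ω₂ t)‖ ≤ ‖B‖ * ‖ω₂ t‖ * (‖ω₁‖ + C₂) := by
      refine (hBB _ _).trans ?_
      gcongr
      exact (norm_add_le _ _).trans (add_le_add (hC₁ t) (hC₂ t))
    have n3 := norm_add₃_le (a := B (ω₁ t) (ω₂ t)) (b := B (ω₂ t) (ω₁ t + ω₂ t)) (c := f₂ t)
    simp only [hg₂]
    linarith
  have hPg : IsPAP0 g₂ := by
    refine ⟨hg₂c, ⟨‖B‖ * (2 * ‖ω₁‖ + C₂) * C₂ + D₂, fun t => (hbd t).trans ?_⟩, ?_⟩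
    · gcongr
      · exact hC₂ t
      · exact hD₂ t
    · refine mean_mono _ (fun t => ‖B‖ * (2 * ‖ω₁‖ + C₂) * ‖ω₂ t‖ + ‖f₂ t‖) hg₂c.norm
        (by fun_prop) (fun _ => norm_nonneg _) hbd ?_
      have := (hω₂m.const_mul (‖B‖ * (2 * ‖ω₁‖ + C₂))).add hf₂m
      rw [mul_zero, add_zero] at this
      refine this.congr fun L => ?_
      rw [intervalIntegral.integral_add
        ((by fun_prop : Continuous fun t =>
          ‖B‖ * (2 * ‖ω₁‖ + C₂) * ‖ω₂ t‖).intervalIntegrable _ _)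
        (hf₂c.norm.intervalIntegrable _ _), intervalIntegral.integral_const_mul]
      ring
  refine ⟨_, _, conv_AP T M hTcont hMc hMi hT g₁ hAPg, conv_PAP0 T M hTcont hMc hMi hT g₂ hPg,
    fun t => ?_⟩
  obtain ⟨_, ⟨E₁, hE₁⟩, _⟩ := hAPg
  obtain ⟨_, ⟨E₂, hE₂⟩, _⟩ := hPg
  rw [← integral_add (conv_integrable T M hTcont hMc hMi hT g₁ hg₁c E₁ hE₁ t)
    (conv_integrable T M hTcont hMc hMi hT g₂ hg₂c E₂ hE₂ t),
    conv_change T (fun s => B (ω₁ s + ω₂ s) (ω₁ s + ω₂ s) + (f₁ s + f₂ s)) t]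
  congr 1
  ext τ
  rw [← map_add]
  congr 1
  simp only [hg₁, hg₂, map_add, add_apply]
  abel
end
end

section
/- Let X and Y be real Banach spaces, let T : (0,∞) → L(Y,X) be a family of bounded linear operators such that for every y ∈ Y the map τ ↦ T(τ)y is continuous on (0,∞) and ‖T(τ)‖ ≤ k(1 + τ^{−a})e^{−λτ} for all τ > 0 (with constants k > 0, λ > 0, a ∈ (0,1)), let B : X × X → Y be a continuous bilinear map with ‖B(x,x')‖_Y ≤ c‖x‖_X‖x'‖_X, and let S : (0,∞) → L(X,X) be a family of bounded linear operators such that t ↦ S(t)x is continuous for every x ∈ X. Let f ∈ C_b(ℝ,Y), and let û, u : [0,∞) → X be continuous functions with sup_{t≥0}‖û(t)‖ ≤ ρ and sup_{t≥0}‖u(t)‖ ≤ ρ̃, each satisfying v(t) = S(t)v(0) + ∫₀^t T(t−s)(B(v(s),v(s)) + f(s)) ds for all t > 0. Let 0 < σ < λ, set L_σ = 1/(λ−σ) + Γ(1−a)(λ−σ)^{a−1}, and assume kc(ρ+ρ̃)L_σ < 1. Then lim_{t→∞} e^{σt}‖S(t)(û(0) − u(0))‖_X = 0 if and only if lim_{t→∞}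 e^{σt}‖û(t) − u(t)‖_X = 0. -/
open MeasureTheory Set Filter

noncomputable section

lemma aux_conv_integrable (g φ : ℝ → ℝ) (hg0 : ∀ τ > 0, 0 ≤ g τ) (hg : IntegrableOn g (Ioi 0))
    (hφm : Measurable φ) (hφ0 : ∀ t, 0 ≤ φ t) (t K : ℝ) (hK : ∀ s < t, φ s ≤ K) :
    IntegrableOn (fun τ => g τ * φ (t - τ)) (Ioi 0) := by
  have hm : AEStronglyMeasurable (fun τ => g τ * φ (t - τ)) (volume.restrict (Ioi 0)) :=
    hg.aestronglyMeasurable.mul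
      (hφm.comp (measurable_const.sub measurable_id)).aestronglyMeasurable
  refine Integrable.mono' (hg.mul_const K) hm ?_
  filter_upwards [ae_restrict_mem measurableSet_Ioi] with τ hτ
  have hτ' : 0 < τ := hτ
  rw [Real.norm_of_nonneg (mul_nonneg (hg0 τ hτ) (hφ0 _))]
  exact mul_le_mul_of_nonneg_left (hK _ (by linarith)) (hg0 τ hτ)

lemma aux_conv_le (g φ : ℝ → ℝ) (hg0 : ∀ τ > 0, 0 ≤ g τ) (hg : IntegrableOn g (Ioi 0))
    (hφm : Measurable φ) (hφ0 : ∀ t, 0 ≤ φ t) (t K : ℝ) (hK : ∀ s < t, φ s ≤ K) :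
    ∫ τ in Ioi 0, g τ * φ (t - τ) ≤ (∫ τ in Ioi 0, g τ) * K := by
  rw [← integral_mul_const]
  refine setIntegral_mono_on (aux_conv_integrable g φ hg0 hg hφm hφ0 t K hK)
    (hg.mul_const K) measurableSet_Ioi ?_
  intro τ hτ
  have hτ' : 0 < τ := hτ
  exact mul_le_mul_of_nonneg_left (hK _ (by linarith)) (hg0 τ hτ)

lemma aux_conv_tendsto (g φ : ℝ → ℝ) (hg0 : ∀ τ > 0, 0 ≤ g τ) (hg : IntegrableOn g (Ioi 0))
    (hφm : Measurable φ) (hφ0 : ∀ t, 0 ≤ φ t) (K : ℝ) (hK : ∀ s, φ s ≤ K)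
    (hlim : Tendsto φ atTop (nhds 0)) :
    Tendsto (fun t => ∫ τ in Ioi 0, g τ * φ (t - τ)) atTop (nhds 0) := by
  suffices H : Tendsto (fun t => ∫ τ in Ioi (0:ℝ), g τ * φ (t - τ)) atTop
      (nhds (∫ _τ in Ioi (0:ℝ), (0:ℝ))) by simpa using H
  refine tendsto_integral_filter_of_dominated_convergence (fun τ => g τ * K) ?_ ?_
    (hg.mul_const K) ?_
  · refine Eventually.of_forall fun t => ?_
    exact (aux_conv_integrable g φ hg0 hg hφm hφ0 t K (fun s _ => hK s)).aestronglyMeasurable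
  · refine Eventually.of_forall fun t => ?_
    filter_upwards [ae_restrict_mem measurableSet_Ioi] with τ hτ
    rw [Real.norm_of_nonneg (mul_nonneg (hg0 τ hτ) (hφ0 _))]
    exact mul_le_mul_of_nonneg_left (hK _) (hg0 τ hτ)
  · refine Eventually.of_forall fun τ => ?_
    have : Tendsto (fun t : ℝ => φ (t - τ)) atTop (nhds 0) :=
      hlim.comp (tendsto_atTop_add_const_right atTop (-τ) tendsto_id)
    simpa using this.const_mul (g τ)

lemma aux_bdd (g φ ψ : ℝ → ℝ) (hg0 : ∀ τ > 0, 0 ≤ g τ) (hg : IntegrableOn g (Ioi 0))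
    (hq : ∫ τ in Ioi 0, g τ < 1)
    (hφm : Measurable φ) (hφ0 : ∀ t, 0 ≤ φ t) (hφb : ∀ R, ∃ K, ∀ t ≤ R, φ t ≤ K)
    (h : ∀ t > 0, |φ t - ψ t| ≤ ∫ τ in Ioi 0, g τ * φ (t - τ))
    (hψ : ∀ᶠ t in atTop, ψ t ≤ 1) : ∃ K, ∀ t, φ t ≤ K := by
  set q := ∫ τ in Ioi 0, g τ with hqd
  obtain ⟨R0, hR0⟩ := eventually_atTop.1 hψ
  set R1 := max R0 1
  obtain ⟨m, hm⟩ := hφb R1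
  have hm0 : 0 ≤ m := (hφ0 R1).trans (hm R1 le_rfl)
  have hq0 : 0 ≤ q := setIntegral_nonneg measurableSet_Ioi fun τ hτ => hg0 τ hτ
  refine ⟨(m + 1) / (1 - q), fun R => ?_⟩
  obtain ⟨K, hK⟩ := hφb R
  have hbd : BddAbove (φ '' Iic R) := ⟨K, by rintro _ ⟨t, ht, rfl⟩; exact hK t ht⟩
  set s := sSup (φ '' Iic R)
  have hs : ∀ t ≤ R, φ t ≤ s := fun t ht => le_csSup hbd ⟨t, ht, rfl⟩
  have hs0 : 0 ≤ s := (hφ0 R).trans (hs R le_rfl)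
  have key : s ≤ m + 1 + q * s := by
    refine csSup_le ⟨φ R, R, self_mem_Iic, rfl⟩ ?_
    rintro _ ⟨t, ht, rfl⟩
    have ht' : t ≤ R := ht
    rcases le_total t R1 with h1 | h1
    · have := hm t h1
      nlinarith [mul_nonneg hq0 hs0]
    · have ht0 : 0 < t := lt_of_lt_of_le (by norm_num) ((le_max_right R0 1).trans h1)
      have h2 := h t ht0
      have h3 := aux_conv_le g φ hg0 hg hφm hφ0 t s (fun s hs' => hs s (by linarith))
      have h4 := hR0 t ((le_max_left R0 1).trans h1)
      have h5 := (abs_le.1 h2).2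
      linarith
  refine (hs R le_rfl).trans ?_
  rw [le_div_iff₀ (by linarith)]
  linarith

lemma aux_step (g φ ψ : ℝ → ℝ) (hg0 : ∀ τ > 0, 0 ≤ g τ) (hg : IntegrableOn g (Ioi 0))
    (hφm : Measurable φ) (hφ0 : ∀ t, 0 ≤ φ t) (K : ℝ) (hK : ∀ t, φ t ≤ K)
    (h : ∀ t > 0, |φ t - ψ t| ≤ ∫ τ in Ioi 0, g τ * φ (t - τ))
    (hψ : Tendsto ψ atTop (nhds 0)) (ε δ : ℝ) (hε : 0 ≤ ε) (hδ : 0 < δ)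
    (hev : ∀ᶠ t in atTop, φ t ≤ ε) :
    ∀ᶠ t in atTop, φ t ≤ δ + (∫ τ in Ioi 0, g τ) * ε := by
  have hχm : Measurable (fun t => max (φ t - ε) 0) := (hφm.sub_const ε).max measurable_const
  have hχK : ∀ t, max (φ t - ε) 0 ≤ K := fun t =>
    max_le (by linarith [hK t]) ((hφ0 t).trans (hK t))
  have hχ0 : ∀ t, 0 ≤ max (φ t - ε) 0 := fun t => le_max_right _ _
  have hχl : Tendsto (fun t => max (φ t - ε) 0) atTop (nhds 0) := by
    refine tendsto_const_nhds.congr' ?_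
    filter_upwards [hev] with t ht
    rw [max_eq_right (by linarith)]
  have hc := aux_conv_tendsto g _ hg0 hg hχm hχ0 K hχK hχl
  filter_upwards [hc.eventually_lt_const (half_pos hδ), hψ.eventually_lt_const (half_pos hδ),
    eventually_gt_atTop 0] with t h1 h2 h3
  have h4 := (abs_le.1 (h t h3)).2
  have hi := aux_conv_integrable g _ hg0 hg hχm hχ0 t K (fun s _ => hχK s)
  have h5 : ∫ τ in Ioi 0, g τ * φ (t - τ) ≤
      ∫ τ in Ioi 0, (g τ * ε + g τ * max (φ (t - τ) - ε) 0) := by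
    refine setIntegral_mono_on (aux_conv_integrable g φ hg0 hg hφm hφ0 t K (fun s _ => hK s))
      ((hg.mul_const ε).add hi) measurableSet_Ioi ?_
    intro τ hτ
    rw [← mul_add]
    exact mul_le_mul_of_nonneg_left (by linarith [le_max_left (φ (t - τ) - ε) 0]) (hg0 τ hτ)
  rw [integral_add (hg.mul_const ε) hi, integral_mul_const] at h5
  linarith

lemma aux_main (g φ ψ : ℝ → ℝ) (hg0 : ∀ τ > 0, 0 ≤ g τ) (hg : IntegrableOn g (Ioi 0))
    (hq : ∫ τ in Ioi 0, g τ < 1)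
    (hφm : Measurable φ) (hφ0 : ∀ t, 0 ≤ φ t) (hφb : ∀ R, ∃ K, ∀ t ≤ R, φ t ≤ K)
    (h : ∀ t > 0, |φ t - ψ t| ≤ ∫ τ in Ioi 0, g τ * φ (t - τ)) :
    Tendsto ψ atTop (nhds 0) ↔ Tendsto φ atTop (nhds 0) := by
  have hq0 : 0 ≤ ∫ τ in Ioi 0, g τ := setIntegral_nonneg measurableSet_Ioi fun τ hτ => hg0 τ hτ
  constructor
  · intro hψ
    obtain ⟨K, hK⟩ := aux_bdd g φ ψ hg0 hg hq hφm hφ0 hφb h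
      ((hψ.eventually_lt_const one_pos).mono fun _ h => h.le)
    have hstep := aux_step g φ ψ hg0 hg hφm hφ0 K hK h hψ
    have hK0 : 0 ≤ K := (hφ0 0).trans (hK 0)
    set q := ∫ τ in Ioi 0, g τ with hqd
    have h1q : 0 < 1 - q := by linarith
    have hit : ∀ δ > 0, ∀ n : ℕ, ∀ᶠ t in atTop, φ t ≤ q ^ n * K + δ / (1 - q) := by
      intro δ hδ n
      induction n with
      | zero =>
        refine Eventually.of_forall fun t => ?_
        have := div_pos hδ h1q
        have := hK t
        simp only [pow_zero, one_mul]; linarith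
      | succ n ih =>
        have := hstep _ δ (by positivity) hδ ih
        filter_upwards [this] with t ht
        refine ht.trans (le_of_eq ?_)
        field_simp
        ring
    rw [Metric.tendsto_nhds]
    intro ε hε
    have hp : Tendsto (fun n : ℕ => q ^ n * K) atTop (nhds 0) := by
      simpa using (tendsto_pow_atTop_nhds_zero_of_lt_one hq0 hq).mul_const K
    obtain ⟨n, hn⟩ := (hp.eventually_lt_const (half_pos hε)).exists
    filter_upwards [hit (ε / 2 * (1 - q)) (by positivity) n] with t ht
    rw [mul_div_assoc, div_self h1q.ne', mul_one] at ht
    rw [Real.dist_eq, sub_zero, abs_of_nonneg (hφ0 t)]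
    linarith
  · intro hφ
    obtain ⟨R, hR⟩ := eventually_atTop.1 (hφ.eventually_lt_const one_pos)
    obtain ⟨K, hK⟩ := hφb R
    have hK' : ∀ t, φ t ≤ max K 1 := fun t => by
      rcases le_total t R with h1 | h1
      · exact (hK t h1).trans (le_max_left _ _)
      · exact (hR t h1).le.trans (le_max_right _ _)
    have hc := aux_conv_tendsto g φ hg0 hg hφm hφ0 _ hK' hφ
    have hd : Tendsto (fun t => φ t - ψ t) atTop (nhds 0) := by
      refine squeeze_zero_norm' ?_ hc
      filter_upwards [eventually_gt_atTop 0] with t ht using h t ht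
    simpa using hφ.sub hd

lemma aux_kernel (a b C : ℝ) (ha : a ∈ Ioo (0:ℝ) 1) (hb : 0 < b) :
    IntegrableOn (fun τ => C * ((1 + τ ^ (-a)) * Real.exp (-b * τ))) (Ioi 0) ∧
    ∫ τ in Ioi (0:ℝ), C * ((1 + τ ^ (-a)) * Real.exp (-b * τ)) =
      C * (1 / b + Real.Gamma (1 - a) * b ^ (a - 1)) := by
  have i1 : IntegrableOn (fun τ : ℝ => Real.exp (-b * τ)) (Ioi 0) :=
    integrableOn_exp_mul_Ioi (by linarith) 0
  have i2 : IntegrableOn (fun τ : ℝ => τ ^ (-a) * Real.exp (-b * τ)) (Ioi 0) := by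
    have := integrableOn_rpow_mul_exp_neg_mul_rpow (s := -a) (p := 1) (b := b)
      (by linarith [ha.2]) one_pos hb
    simpa using this
  have e : (fun τ : ℝ => C * ((1 + τ ^ (-a)) * Real.exp (-b * τ))) =
      fun τ => C * (Real.exp (-b * τ) + τ ^ (-a) * Real.exp (-b * τ)) := by
    funext τ; ring
  rw [e]
  refine ⟨(i1.add i2).const_mul C, ?_⟩
  rw [integral_const_mul, integral_add i1 i2, integral_exp_mul_Ioi (by linarith)]
  have := Real.integral_rpow_mul_exp_neg_mul_Ioi (a := 1 - a) (r := b) (by linarith [ha.2]) hb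
  have e2 : ∫ τ in Ioi (0:ℝ), τ ^ (-a) * Real.exp (-b * τ) =
      Real.Gamma (1 - a) * b ^ (a - 1) := by
    rw [show (1 - a - 1 : ℝ) = -a by ring] at this
    simp only [neg_mul]
    rw [this, one_div, Real.inv_rpow hb.le, ← Real.rpow_neg hb.le, mul_comm]
    congr 2; ring
  rw [e2]
  congr 2
  simp [neg_div_neg_eq]

theorem stmt3
    {X Y : Type*} [NormedAddCommGroup X] [NormedSpace ℝ X] [CompleteSpace X]
    [NormedAddCommGroup Y] [NormedSpace ℝ Y]
    (T : ℝ → Y →L[ℝ] X)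
    (hTcont : ∀ y : Y, ContinuousOn (fun τ : ℝ => T τ y) (Ioi 0))
    (k lam a c : ℝ) (hk : 0 < k) (hlam : 0 < lam) (ha : a ∈ Ioo (0:ℝ) 1)
    (hT : ∀ τ : ℝ, 0 < τ → ‖T τ‖ ≤ k * (1 + τ ^ (-a)) * Real.exp (-lam * τ))
    (B : X →L[ℝ] X →L[ℝ] Y)
    (hB : ∀ x x' : X, ‖B x x'‖ ≤ c * ‖x‖ * ‖x'‖)
    (S : ℝ → X →L[ℝ] X)
    (hScont : ∀ x : X, ContinuousOn (fun t : ℝ => S t x) (Ioi 0))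
    (f : BoundedContinuousFunction ℝ Y)
    (uh u : ℝ → X) (ρ ρ' : ℝ)
    (huhc : ContinuousOn uh (Ici 0)) (huc : ContinuousOn u (Ici 0))
    (huhb : ∀ t ≥ (0:ℝ), ‖uh t‖ ≤ ρ) (hub : ∀ t ≥ (0:ℝ), ‖u t‖ ≤ ρ')
    (huhint : ∀ t > (0:ℝ),
      IntervalIntegrable (fun s : ℝ => T (t - s) (B (uh s) (uh s) + f s)) volume 0 t)
    (huheq : ∀ t > (0:ℝ),
      uh t = S t (uh 0) + ∫ s in (0:ℝ)..t, T (t - s) (B (uh s) (uh s) + f s))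
    (huint : ∀ t > (0:ℝ),
      IntervalIntegrable (fun s : ℝ => T (t - s) (B (u s) (u s) + f s)) volume 0 t)
    (hueq : ∀ t > (0:ℝ),
      u t = S t (u 0) + ∫ s in (0:ℝ)..t, T (t - s) (B (u s) (u s) + f s))
    (σ : ℝ) (hσ : 0 < σ) (hσlam : σ < lam)
    (hsmall : k * c * (ρ + ρ') *
      (1 / (lam - σ) + Real.Gamma (1 - a) * (lam - σ) ^ (a - 1)) < 1) :
    Tendsto (fun t : ℝ => Real.exp (σ * t) * ‖S t (uh 0 - u 0)‖) atTop (nhds 0) ↔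
      Tendsto (fun t : ℝ => Real.exp (σ * t) * ‖uh t - u t‖) atTop (nhds 0) := by
  -- reduce to c ≥ 0
  wlog hc : 0 ≤ c generalizing c
  · push Not at hc
    refine this 0 (fun x x' => ?_) (by simp) le_rfl
    refine (hB x x').trans ?_
    have := mul_nonneg (norm_nonneg x) (norm_nonneg x')
    nlinarith
  have hρ : 0 ≤ ρ := (norm_nonneg _).trans (huhb 0 le_rfl)
  have hρ' : 0 ≤ ρ' := (norm_nonneg _).trans (hub 0 le_rfl)
  have hb : 0 < lam - σ := by linarith
  obtain ⟨hgi, hgv⟩ := aux_kernel a (lam - σ) (k * c * (ρ + ρ')) ha hb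
  set g : ℝ → ℝ := fun τ => k * c * (ρ + ρ') * ((1 + τ ^ (-a)) * Real.exp (-(lam - σ) * τ)) with hgd
  have hg0 : ∀ τ > 0, 0 ≤ g τ := fun τ hτ => by
    have := Real.rpow_nonneg (le_of_lt hτ) (-a)
    simp only [hgd]; positivity
  set φ : ℝ → ℝ := (Ici (0:ℝ)).indicator (fun t => Real.exp (σ * t) * ‖uh t - u t‖) with hφd
  have hcont : ContinuousOn (fun t => Real.exp (σ * t) * ‖uh t - u t‖) (Ici (0:ℝ)) :=
    ContinuousOn.mul (by fun_prop) (huhc.sub huc).norm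
  have hφm : Measurable φ := by
    have : φ = (Ici (0:ℝ)).piecewise (fun t => Real.exp (σ * t) * ‖uh t - u t‖) (fun _ => 0) := by
      rw [hφd]; exact (Set.piecewise_eq_indicator).symm
    rw [this]
    exact hcont.measurable_piecewise continuousOn_const measurableSet_Ici
  have hφ0 : ∀ t, 0 ≤ φ t := fun t => indicator_nonneg (fun t _ => by positivity) t
  have hφp : ∀ t, 0 ≤ t → φ t = Real.exp (σ * t) * ‖uh t - u t‖ := fun t ht =>
    indicator_of_mem (mem_Ici.2 ht) _
  have hφb : ∀ R, ∃ K, ∀ t ≤ R, φ t ≤ K := fun R => by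
    refine ⟨Real.exp (σ * R) * (ρ + ρ'), fun t ht => ?_⟩
    rcases lt_or_ge t 0 with h | h
    · rw [hφd, indicator_of_notMem (by simpa using h)]
      positivity
    · rw [hφp t h]
      refine mul_le_mul (Real.exp_le_exp.2 (by nlinarith)) ?_ (norm_nonneg _) (Real.exp_pos _).le
      exact (norm_sub_le _ _).trans (add_le_add (huhb t h) (hub t h))
  have key : ∀ t > 0, |φ t - Real.exp (σ * t) * ‖S t (uh 0 - u 0)‖| ≤
      ∫ τ in Ioi 0, g τ * φ (t - τ) := by
    intro t ht
    obtain ⟨K, hK⟩ := hφb t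
    have hint := aux_conv_integrable g φ hg0 hgi hφm hφ0 t K (fun s hs => hK s hs.le)
    have hw : uh t - u t - S t (uh 0 - u 0) =
        ∫ s in (0:ℝ)..t, T (t - s) (B (uh s) (uh s) - B (u s) (u s)) := by
      rw [huheq t ht, hueq t ht, map_sub]
      have : ∫ s in (0:ℝ)..t, T (t - s) (B (uh s) (uh s) - B (u s) (u s)) =
          (∫ s in (0:ℝ)..t, T (t - s) (B (uh s) (uh s) + f s)) -
          ∫ s in (0:ℝ)..t, T (t - s) (B (u s) (u s) + f s) := by
        rw [← intervalIntegral.integral_sub (huhint t ht) (huint t ht)]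
        congr 1
        funext s
        rw [← map_sub]
        congr 1
        abel
      rw [this]
      abel
    have hw2 : Real.exp (σ * t) • (uh t - u t - S t (uh 0 - u 0)) =
        ∫ τ in Ioc 0 t, Real.exp (σ * t) •
          T τ (B (uh (t - τ)) (uh (t - τ)) - B (u (t - τ)) (u (t - τ))) := by
      rw [hw, integral_smul, ← intervalIntegral.integral_of_le ht.le]
      congr 1
      have := intervalIntegral.integral_comp_sub_left (a := 0) (b := t)
        (fun s => T (t - s) (B (uh s) (uh s) - B (u s) (u s))) t
      simp only [sub_sub_cancel, sub_self, sub_zero] at this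
      exact this.symm
    have hb1 : ‖Real.exp (σ * t) • (uh t - u t - S t (uh 0 - u 0))‖ ≤
        ∫ τ in Ioc 0 t, g τ * φ (t - τ) := by
      rw [hw2]
      refine norm_integral_le_of_norm_le (hint.mono_set Ioc_subset_Ioi_self) ?_
      filter_upwards [ae_restrict_mem measurableSet_Ioc] with τ hτ
      have hs : 0 ≤ t - τ := by linarith [hτ.2]
      rw [hφp _ hs, norm_smul, Real.norm_of_nonneg (Real.exp_pos _).le]
      set x := uh (t - τ)
      set y := u (t - τ)
      have hBd : ‖B x x - B y y‖ ≤ c * (ρ + ρ') * ‖x - y‖ := by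
        have e : B x x - B y y = B x (x - y) + B (x - y) y := by
          simp only [map_sub, sub_apply]; abel
        rw [e]
        refine (norm_add_le _ _).trans ((add_le_add (hB _ _) (hB _ _)).trans ?_)
        have h1 : ‖x‖ ≤ ρ := huhb _ hs
        have h2 : ‖y‖ ≤ ρ' := hub _ hs
        have h3 : c * ‖x - y‖ * (‖x‖ + ‖y‖) ≤ c * ‖x - y‖ * (ρ + ρ') := by gcongr
        linarith
      have h0 := hT τ hτ.1
      have h4 : ‖T τ (B x x - B y y)‖ ≤
          (k * (1 + τ ^ (-a)) * Real.exp (-lam * τ)) * (c * (ρ + ρ') * ‖x - y‖) :=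
        ((T τ).le_opNorm _).trans
          (mul_le_mul h0 hBd (norm_nonneg _) ((norm_nonneg _).trans h0))
      refine (mul_le_mul_of_nonneg_left h4 (Real.exp_pos _).le).trans (le_of_eq ?_)
      simp only [hgd]
      have e1 : Real.exp (σ * t) * Real.exp (-lam * τ) =
          Real.exp (-(lam - σ) * τ) * Real.exp (σ * (t - τ)) := by
        rw [← Real.exp_add, ← Real.exp_add]; congr 1; ring
      linear_combination (k * (1 + τ ^ (-a)) * (c * (ρ + ρ') * ‖x - y‖)) * e1
    have hb2 : ∫ τ in Ioc 0 t, g τ * φ (t - τ) ≤ ∫ τ in Ioi 0, g τ * φ (t - τ) := by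
      refine setIntegral_mono_set hint ?_ (Ioc_subset_Ioi_self.eventuallyLE)
      filter_upwards [ae_restrict_mem measurableSet_Ioi] with τ hτ
      exact mul_nonneg (hg0 τ hτ) (hφ0 _)
    refine le_trans ?_ (hb1.trans hb2)
    rw [hφp t ht.le, norm_smul, Real.norm_of_nonneg (Real.exp_pos _).le, ← mul_sub, abs_mul,
      abs_of_pos (Real.exp_pos _)]
    exact mul_le_mul_of_nonneg_left (abs_norm_sub_norm_le _ _) (Real.exp_pos _).le
  rw [aux_main g φ _ hg0 hgi (by rw [hgv]; exact hsmall) hφm hφ0 hφb key]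
  refine tendsto_congr' ?_
  filter_upwards [eventually_ge_atTop 0] with t ht using hφp t ht
end
end

section
/- Let a ∈ (0,1) and λ > 0, and let w : ℝ → [0,∞) be a bounded continuous function with lim_{L→∞} (1/(2L)) ∫_{−L}^{L} w(t) dt = 0. Then lim_{L→∞} (1/(2L)) ∫_{−L}^{L} ( ∫₀^{∞} (1 + s^{−a}) e^{−λs} w(t−s) ds ) dt = 0. -/
open MeasureTheory Set Filter

noncomputable section

theorem stmt9
    (a lam : ℝ) (ha : a ∈ Ioo (0:ℝ) 1) (hlam : 0 < lam)
    (w : ℝ → ℝ) (hwc : Continuous w) (hwpos : ∀ t : ℝ, 0 ≤ w t)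
    (hwbdd : ∃ C : ℝ, ∀ t : ℝ, w t ≤ C)
    (hmean : Tendsto (fun L : ℝ => (1 / (2 * L)) * ∫ t in (-L)..L, w t) atTop (nhds 0)) :
    Tendsto (fun L : ℝ => (1 / (2 * L)) * ∫ t in (-L)..L,
      ∫ s in Ioi (0:ℝ), (1 + s ^ (-a)) * Real.exp (-lam * s) * w (t - s))
      atTop (nhds 0) := by
  obtain ⟨C, hC⟩ := hwbdd
  obtain ⟨ha0, ha1⟩ := ha
  have hwi : ∀ x y : ℝ, IntervalIntegrable w volume x y := fun x y => hwc.intervalIntegrable x y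
  set k : ℝ → ℝ := fun s => (1 + s ^ (-a)) * Real.exp (-lam * s) with hk
  have hkpos : ∀ s ∈ Ioi (0:ℝ), 0 ≤ k s := by
    intro s hs
    have := Real.rpow_nonneg (le_of_lt hs) (-a)
    simp only [hk]
    positivity
  have hki : IntegrableOn k (Ioi 0) := by
    have h1 := integrableOn_rpow_mul_exp_neg_mul_rpow (p := 1) (s := -a) (b := lam)
      (by linarith) one_pos hlam
    have h2 := integrableOn_rpow_mul_exp_neg_mul_rpow (p := 1) (s := 0) (b := lam)
      (by linarith) one_pos hlam
    refine (h2.add h1).congr_fun (fun s _ => ?_) measurableSet_Ioi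
    simp [hk]
    ring
  -- the swap
  have hswap : ∀ L : ℝ, (1 / (2 * L)) * ∫ t in (-L)..L, ∫ s in Ioi (0:ℝ), k s * w (t - s)
      = ∫ s in Ioi (0:ℝ), k s * ((1 / (2 * L)) * ∫ t in (-L)..L, w (t - s)) := by
    intro L
    rw [intervalIntegral_integral_swap, ← integral_const_mul]
    · refine integral_congr_ae (Eventually.of_forall fun s => ?_)
      simp only [intervalIntegral.integral_const_mul]
      ring
    · have h1 : Integrable (fun _ : ℝ => (1:ℝ)) (volume.restrict (Set.uIoc (-L) L)) :=
        integrableOn_const (by simp [Set.uIoc])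
      have h2 := h1.mul_prod hki
      have h3 := h2.mul_bdd (c := C) (g := fun z : ℝ × ℝ => w (z.1 - z.2))
        (by exact (hwc.comp (continuous_fst.sub continuous_snd)).aestronglyMeasurable)
        (Eventually.of_forall fun z => by
          rw [Real.norm_eq_abs, abs_of_nonneg (hwpos _)]; exact hC _)
      refine h3.congr (Eventually.of_forall fun z => ?_)
      simp [Function.uncurry]
  have hnn : ∀ s L : ℝ, 0 < L → 0 ≤ (1 / (2 * L)) * ∫ t in (-L)..L, w (t - s) := by
    intro s L hL
    have : 0 ≤ ∫ t in (-L)..L, w (t - s) :=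
      intervalIntegral.integral_nonneg (by linarith) fun t _ => hwpos _
    positivity
  have hptw : ∀ s ∈ Ioi (0:ℝ),
      Tendsto (fun L : ℝ => (1 / (2 * L)) * ∫ t in (-L)..L, w (t - s)) atTop (nhds 0) := by
    intro s hs
    have hs : 0 < s := hs
    have hinv : Tendsto (fun L : ℝ => 1 / (2 * L)) atTop (nhds 0) := by
      simp only [one_div]
      exact tendsto_inv_atTop_zero.comp (tendsto_id.const_mul_atTop two_pos)
    have hup : Tendsto (fun L : ℝ => (1 / (2 * L)) * (C * s) +
        (1 / (2 * L)) * ∫ t in (-L)..L, w t) atTop (nhds 0) := by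
      simpa using (hinv.mul_const (C * s)).add hmean
    refine tendsto_of_tendsto_of_tendsto_of_le_of_le' tendsto_const_nhds hup ?_ ?_
    · filter_upwards [eventually_gt_atTop 0] with L hL using hnn s L hL
    · filter_upwards [eventually_gt_atTop 0] with L hL
      rw [← mul_add]
      refine mul_le_mul_of_nonneg_left ?_ (by positivity)
      rw [intervalIntegral.integral_comp_sub_right (fun t => w t) s]
      have e1 := intervalIntegral.integral_add_adjacent_intervals
        (hwi (-L - s) (L - s)) (hwi (L - s) L)
      have e2 := intervalIntegral.integral_add_adjacent_intervals
        (hwi (-L - s) (-L)) (hwi (-L) L)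
      have e3 : 0 ≤ ∫ t in (L - s)..L, w t :=
        intervalIntegral.integral_nonneg (by linarith) fun t _ => hwpos _
      have e4 : ∫ t in (-L - s)..(-L), w t ≤ ∫ t in (-L - s)..(-L), C :=
        intervalIntegral.integral_mono_on (by linarith) (hwi _ _) (by simp) fun t _ => hC t
      rw [intervalIntegral.integral_const, smul_eq_mul] at e4
      nlinarith
  have hub : ∀ s L : ℝ, 0 < L → (1 / (2 * L)) * ∫ t in (-L)..L, w (t - s) ≤ C := by
    intro s L hL
    have h : ∫ t in (-L)..L, w (t - s) ≤ ∫ t in (-L)..L, C :=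
      intervalIntegral.integral_mono_on (by linarith)
        ((hwc.comp (continuous_id.sub continuous_const)).intervalIntegrable _ _)
        (by simp) fun t _ => hC _
    rw [intervalIntegral.integral_const, smul_eq_mul] at h
    calc _ ≤ (1 / (2 * L)) * ((L - -L) * C) := mul_le_mul_of_nonneg_left h (by positivity)
      _ = C := by field_simp; ring
  have hmain : Tendsto (fun L : ℝ => ∫ s in Ioi (0:ℝ),
      k s * ((1 / (2 * L)) * ∫ t in (-L)..L, w (t - s))) atTop
      (nhds (∫ _s in Ioi (0:ℝ), (0:ℝ))) := by
    refine tendsto_integral_filter_of_dominated_convergence (fun s => k s * C) ?_ ?_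
      (hki.mul_const C) ?_
    · refine Eventually.of_forall fun L => ?_
      refine hki.aestronglyMeasurable.mul (Continuous.aestronglyMeasurable ?_)
      refine continuous_const.mul ?_
      refine intervalIntegral.continuous_parametric_intervalIntegral_of_continuous' ?_ _ _
      exact hwc.comp (continuous_snd.sub continuous_fst)
    · filter_upwards [eventually_gt_atTop 0] with L hL
      refine (ae_restrict_iff' measurableSet_Ioi).2 (Eventually.of_forall fun s hs => ?_)
      rw [Real.norm_eq_abs, abs_of_nonneg (mul_nonneg (hkpos s hs) (hnn s L hL))]
      exact mul_le_mul_of_nonneg_left (hub s L hL) (hkpos s hs)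
    · refine (ae_restrict_iff' measurableSet_Ioi).2 (Eventually.of_forall fun s hs => ?_)
      simpa using (hptw s hs).const_mul (k s)
  rw [integral_zero] at hmain
  exact hmain.congr fun L => (hswap L).symm
end
end

section
/- Let a ∈ (0,1), λ > 0, 0 < σ < λ, θ ≥ 0, and set L_σ = 1/(λ−σ) + Γ(1−a)(λ−σ)^{a−1}, where Γ is the Gamma function. Let w : [0,∞) → [0,∞) be continuous and h : [0,∞) → [0,∞) satisfy sup_{t≥0} e^{σt} h(t) < ∞ and lim_{t→∞} e^{σt} h(t) = 0. Assume that θ L_σ < 1 and that w(t) ≤ h(t) + θ ∫₀^t (1 + (t−s)^{−a}) e^{−λ(t−s)} w(s) ds for all t ≥ 0. Then lim_{t→∞} e^{σt} w(t) = 0. -/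
open MeasureTheory Set Filter

noncomputable section

lemma kernel_facts (a μ : ℝ) (ha : a ∈ Ioo (0:ℝ) 1) (hμ : 0 < μ) :
    IntegrableOn (fun x : ℝ => (1 + x ^ (-a)) * Real.exp (-(μ * x))) (Ioi 0) ∧
    ∫ x in Ioi (0:ℝ), (1 + x ^ (-a)) * Real.exp (-(μ * x)) =
      1 / μ + Real.Gamma (1 - a) * μ ^ (a - 1) := by
  have h1 : IntegrableOn (fun x : ℝ => Real.exp (-(μ * x))) (Ioi 0) := by
    have := integrableOn_exp_mul_Ioi (a := -μ) (by linarith) 0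
    simpa [neg_mul] using this
  have h2 : IntegrableOn (fun x : ℝ => x ^ (-a) * Real.exp (-(μ * x))) (Ioi 0) := by
    have := integrableOn_rpow_mul_exp_neg_mul_rpow (p := 1) (s := -a) (b := μ)
      (by linarith [ha.2]) one_pos hμ
    simpa [neg_mul] using this
  have e1 : ∫ x in Ioi (0:ℝ), Real.exp (-(μ * x)) = 1 / μ := by
    have := integral_exp_mul_Ioi (a := -μ) (by linarith) 0
    simpa [neg_mul] using this
  have e2 : ∫ x in Ioi (0:ℝ), x ^ (-a) * Real.exp (-(μ * x)) =
      Real.Gamma (1 - a) * μ ^ (a - 1) := by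
    have := Real.integral_rpow_mul_exp_neg_mul_Ioi (a := 1 - a) (r := μ)
      (by linarith [ha.2]) hμ
    rw [show (1 - a - 1 : ℝ) = -a by ring] at this
    rw [this, mul_comm, one_div, Real.inv_rpow hμ.le, ← Real.rpow_neg hμ.le, neg_sub]
  have e : (fun x : ℝ => (1 + x ^ (-a)) * Real.exp (-(μ * x))) =
      fun x => Real.exp (-(μ * x)) + x ^ (-a) * Real.exp (-(μ * x)) := by
    ext x; ring
  rw [e]
  refine ⟨h1.add h2, ?_⟩
  rw [integral_add h1 h2, e1, e2]

/-- Abstract version with an integrable nonnegative kernel. -/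
lemma abstract_gronwall (k : ℝ → ℝ) (L θ : ℝ) (hk : IntegrableOn k (Ioi 0))
    (hkpos : ∀ x ≥ 0, 0 ≤ k x) (hL : ∫ x in Ioi (0:ℝ), k x = L)
    (hθ : 0 ≤ θ) (hq : θ * L < 1) (v g : ℝ → ℝ) (hvc : ContinuousOn v (Ici 0))
    (hvpos : ∀ t ≥ 0, 0 ≤ v t) (M : ℝ) (hM : ∀ t ≥ 0, g t ≤ M)
    (hg : Tendsto g atTop (nhds 0))
    (hv : ∀ t ≥ 0, v t ≤ g t + θ * ∫ x in (0:ℝ)..t, k x * v (t - x)) :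
    Tendsto v atTop (nhds 0) := by
  have hki : ∀ x y : ℝ, 0 ≤ x → x ≤ y → IntervalIntegrable k volume x y := by
    intro x y hx hxy
    rw [intervalIntegrable_iff_integrableOn_Ioc_of_le hxy]
    exact hk.mono_set (fun z hz => lt_of_le_of_lt hx hz.1)
  have hkvi : ∀ t x y : ℝ, 0 ≤ x → x ≤ y → y ≤ t →
      IntervalIntegrable (fun x => k x * v (t - x)) volume x y := by
    intro t x y hx hxy hyt
    refine (hki x y hx hxy).mul_continuousOn ?_
    rw [uIcc_of_le hxy]
    refine hvc.comp (by fun_prop) ?_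
    intro z hz
    simp only [mem_Ici, sub_nonneg]
    exact hz.2.trans hyt
  have hKL : ∀ t ≥ 0, ∫ x in (0:ℝ)..t, k x ≤ L := by
    intro t ht
    rw [intervalIntegral.integral_of_le ht, ← hL]
    refine setIntegral_mono_set hk ?_ (HasSubset.Subset.eventuallyLE Ioc_subset_Ioi_self)
    filter_upwards [ae_restrict_mem measurableSet_Ioi] with x hx
    exact hkpos x (le_of_lt hx)
  have hKlim : Tendsto (fun t => ∫ x in (0:ℝ)..t, k x) atTop (nhds L) := by
    rw [← hL]
    exact intervalIntegral_tendsto_integral_Ioi 0 hk tendsto_id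
  -- bound on a piece
  have hpiece : ∀ t x y C : ℝ, 0 ≤ x → x ≤ y → y ≤ t → (∀ z ∈ Icc x y, v (t - z) ≤ C) →
      ∫ z in x..y, k z * v (t - z) ≤ C * ∫ z in x..y, k z := by
    intro t x y C hx hxy hyt hC
    rw [← intervalIntegral.integral_const_mul]
    refine intervalIntegral.integral_mono_on hxy (hkvi t x y hx hxy hyt)
      ((hki x y hx hxy).const_mul C) ?_
    intro z hz
    rw [mul_comm C]
    exact mul_le_mul_of_nonneg_left (hC z hz) (hkpos z (hx.trans hz.1))
  -- boundedness
  have hbdd : ∀ t ≥ 0, v t ≤ M / (1 - θ * L) := by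
    intro T hT
    obtain ⟨t, ht, hmax⟩ := isCompact_Icc.exists_isMaxOn (nonempty_Icc.2 hT)
      (hvc.mono Icc_subset_Ici_self)
    have hmax' : ∀ s ∈ Icc 0 T, v s ≤ v t := fun s hs => hmax hs
    have h1 := hpiece t 0 t (v t) le_rfl ht.1 le_rfl (fun z hz => hmax' _
      ⟨by linarith [hz.2], by linarith [hz.1, ht.2]⟩)
    have h2 : v t * ∫ z in (0:ℝ)..t, k z ≤ v t * L :=
      mul_le_mul_of_nonneg_left (hKL t ht.1) (hvpos t ht.1)
    have h3 := mul_le_mul_of_nonneg_left (h1.trans h2) hθ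
    have h4 := hv t ht.1
    have h5 := hM t ht.1
    refine (hmax' T ⟨hT, le_rfl⟩).trans ?_
    rw [le_div_iff₀ (by linarith)]
    nlinarith
  set B := M / (1 - θ * L) with hB
  have hB0 : 0 ≤ B := (hvpos 0 le_rfl).trans (hbdd 0 le_rfl)
  have hL0 : 0 ≤ L := by
    simpa using hKL 0 le_rfl
  have step : ∀ c ≥ 0, (∀ᶠ t in atTop, v t ≤ c) → ∀ ε > 0,
      ∀ᶠ t in atTop, v t ≤ ε + θ * L * c := by
    intro c hc hev ε hε
    obtain ⟨T0, hT0⟩ := eventually_atTop.1 hev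
    set T := max T0 0
    have hT : 0 ≤ T := le_max_right _ _
    have hlim : Tendsto (fun t => g t + θ * (B * ((∫ x in (0:ℝ)..t, k x) -
        ∫ x in (0:ℝ)..(t - T), k x))) atTop (nhds 0) := by
      have h1 : Tendsto (fun t : ℝ => ∫ x in (0:ℝ)..(t - T), k x) atTop (nhds L) :=
        hKlim.comp (tendsto_atTop_add_const_right atTop (-T) tendsto_id)
      have := hg.add (((hKlim.sub h1).const_mul B).const_mul θ)
      simpa using this
    filter_upwards [hlim.eventually_lt_const hε, eventually_ge_atTop T] with t h1 ht
    have hs0 : 0 ≤ t - T := by linarith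
    have hst : t - T ≤ t := by linarith
    have a1 := hpiece t 0 (t - T) c le_rfl hs0 hst
      (fun z hz => hT0 _ ((le_max_left T0 0).trans (by linarith [hz.2] : T ≤ t - z)))
    have a2 := hpiece t (t - T) t B hs0 hst le_rfl
      (fun z hz => hbdd _ (by linarith [hz.2]))
    have a3 := intervalIntegral.integral_add_adjacent_intervals
      (hkvi t 0 (t - T) le_rfl hs0 hst) (hkvi t (t - T) t hs0 hst le_rfl)
    have a4 := intervalIntegral.integral_add_adjacent_intervals
      (hki 0 (t - T) le_rfl hs0) (hki (t - T) t hs0 hst)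
    have a5 := mul_le_mul_of_nonneg_left (hKL _ hs0) hc
    have a6 := hv t (by linarith)
    rw [← a3] at a6
    rw [← a4, add_sub_cancel_left] at h1
    have a7 := mul_le_mul_of_nonneg_left (add_le_add (a1.trans a5) a2) hθ
    nlinarith
  set S := {c : ℝ | 0 ≤ c ∧ ∀ᶠ t in atTop, v t ≤ c} with hS
  have hSne : S.Nonempty := ⟨B, hB0, eventually_atTop.2 ⟨0, hbdd⟩⟩
  have hSb : BddBelow S := ⟨0, fun c hc => hc.1⟩
  have hl0 : 0 ≤ sInf S := le_csInf hSne fun c hc => hc.1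
  have hle : ∀ ε > 0, sInf S ≤ ε + θ * L * (sInf S + ε) := by
    intro ε hε
    obtain ⟨c, hcS, hc⟩ := exists_lt_of_csInf_lt hSne (lt_add_of_pos_right (sInf S) hε)
    have hθL : 0 ≤ θ * L := mul_nonneg hθ hL0
    refine (csInf_le hSb (a := ε + θ * L * c)
      ⟨add_nonneg hε.le (mul_nonneg hθL hcS.1), step c hcS.1 hcS.2 ε hε⟩).trans ?_
    have := mul_le_mul_of_nonneg_left hc.le hθL
    linarith
  have hl : sInf S = 0 := by
    by_contra hne
    have hpos : 0 < sInf S := lt_of_le_of_ne hl0 (Ne.symm hne)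
    have h1 := hle (sInf S * (1 - θ * L) / 4) (by
      have : 0 < 1 - θ * L := by linarith
      positivity)
    have h2 : 0 < sInf S * (1 - θ * L) := mul_pos hpos (by linarith)
    nlinarith
  rw [Metric.tendsto_nhds]
  intro ε hε
  obtain ⟨c, hcS, hc⟩ := exists_lt_of_csInf_lt hSne (hl.symm ▸ hε : sInf S < ε)
  filter_upwards [hcS.2, eventually_ge_atTop 0] with t h1 h2
  rw [Real.dist_eq, sub_zero, abs_of_nonneg (hvpos t h2)]
  linarith

theorem stmt11
    (a lam σ θ : ℝ) (ha : a ∈ Ioo (0:ℝ) 1) (hlam : 0 < lam)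
    (hσ : 0 < σ) (hσlam : σ < lam) (hθ : 0 ≤ θ)
    (hsmall : θ * (1 / (lam - σ) + Real.Gamma (1 - a) * (lam - σ) ^ (a - 1)) < 1)
    (w h : ℝ → ℝ)
    (hwc : ContinuousOn w (Ici 0)) (hwpos : ∀ t ≥ (0:ℝ), 0 ≤ w t)
    (hhpos : ∀ t ≥ (0:ℝ), 0 ≤ h t)
    (hhbdd : ∃ M : ℝ, ∀ t ≥ (0:ℝ), Real.exp (σ * t) * h t ≤ M)
    (hhlim : Tendsto (fun t : ℝ => Real.exp (σ * t) * h t) atTop (nhds 0))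
    (hineq : ∀ t ≥ (0:ℝ), w t ≤ h t +
      θ * ∫ s in (0:ℝ)..t, (1 + (t - s) ^ (-a)) * Real.exp (-lam * (t - s)) * w s) :
    Tendsto (fun t : ℝ => Real.exp (σ * t) * w t) atTop (nhds 0) := by
  obtain ⟨M, hM⟩ := hhbdd
  obtain ⟨k1, k2⟩ := kernel_facts a (lam - σ) ha (by linarith)
  refine abstract_gronwall _ _ θ k1 ?_ k2 hθ hsmall _ (fun t => Real.exp (σ * t) * h t)
    ?_ ?_ M hM hhlim ?_
  · intro x hx
    have := Real.rpow_nonneg hx (-a)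
    positivity
  · exact ContinuousOn.mul (by fun_prop) hwc
  · intro t ht
    exact mul_nonneg (Real.exp_pos _).le (hwpos t ht)
  · intro t ht
    have h1 := mul_le_mul_of_nonneg_left (hineq t ht) (Real.exp_pos (σ * t)).le
    refine h1.trans (le_of_eq ?_)
    rw [mul_add, mul_left_comm, ← intervalIntegral.integral_const_mul]
    congr 2
    have := intervalIntegral.integral_comp_sub_left (a := 0) (b := t)
      (fun s => Real.exp (σ * t) * ((1 + (t - s) ^ (-a)) * Real.exp (-lam * (t - s)) * w s)) t
    rw [sub_self, sub_zero] at this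
    rw [← this]
    congr 1
    ext x
    have e : Real.exp (σ * t) * Real.exp (-lam * x) =
        Real.exp (-((lam - σ) * x)) * Real.exp (σ * (t - x)) := by
      rw [← Real.exp_add, ← Real.exp_add]; congr 1; ring
    rw [sub_sub_cancel]
    linear_combination ((1 + x ^ (-a)) * w (t - x)) * e
end
end

section
/- Let a ∈ (0,1), λ > 0, 0 < σ < λ, θ ≥ 0, C ≥ 0, and set L_σ = 1/(λ−σ) + Γ(1−a)(λ−σ)^{a−1}, where Γ is the Gamma function. Assume θ L_σ < 1. Let w : [0,∞) → [0,∞) be continuous and satisfy w(t) ≤ C e^{−λt} + θ ∫₀^t (1 + (t−s)^{−a}) e^{−λ(t−s)} w(s) ds for all t ≥ 0. Then w(t) ≤ (C/(1 − θL_σ)) e^{−σt} for all t ≥ 0. -/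
open MeasureTheory Set Filter

noncomputable section

theorem kernel_aux (a μ : ℝ) (ha : a ∈ Ioo (0:ℝ) 1) (hμ : 0 < μ) :
    IntegrableOn (fun x : ℝ => (1 + x ^ (-a)) * Real.exp (-μ * x)) (Ioi 0) ∧
    ∫ x in Ioi (0:ℝ), (1 + x ^ (-a)) * Real.exp (-μ * x)
      = 1 / μ + Real.Gamma (1 - a) * μ ^ (a - 1) := by
  have h1 : IntegrableOn (fun x : ℝ => Real.exp (-μ * x)) (Ioi 0) :=
    integrableOn_exp_mul_Ioi (by linarith) 0
  have h2 : IntegrableOn (fun x : ℝ => x ^ (-a) * Real.exp (-μ * x)) (Ioi 0) := by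
    have := integrableOn_rpow_mul_exp_neg_mul_rpow (p := 1) (s := -a) (b := μ)
      (by linarith [ha.2]) one_pos hμ
    simpa using this
  have e : (fun x : ℝ => (1 + x ^ (-a)) * Real.exp (-μ * x)) =
      fun x => Real.exp (-μ * x) + x ^ (-a) * Real.exp (-μ * x) := by
    funext x; ring
  rw [e]
  refine ⟨h1.add h2, ?_⟩
  rw [integral_add h1 h2, integral_exp_mul_Ioi (by linarith) 0]
  have := Real.integral_rpow_mul_exp_neg_mul_Ioi (a := 1 - a) (r := μ) (by linarith [ha.2]) hμ
  have h3 : ∫ x in Ioi (0:ℝ), x ^ (-a) * Real.exp (-μ * x)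
      = (1 / μ) ^ (1 - a) * Real.Gamma (1 - a) := by
    rw [← this]
    congr 1
    funext x
    congr 2 <;> ring
  rw [h3, one_div, Real.inv_rpow hμ.le, ← Real.rpow_neg hμ.le]
  have : -(1 - a) = a - 1 := by ring
  rw [this]
  simp
  ring

theorem stmt13
    (a lam σ θ C : ℝ) (ha : a ∈ Ioo (0:ℝ) 1) (hlam : 0 < lam)
    (hσ : 0 < σ) (hσlam : σ < lam) (hθ : 0 ≤ θ) (hC : 0 ≤ C)
    (L : ℝ) (hL : L = 1 / (lam - σ) + Real.Gamma (1 - a) * (lam - σ) ^ (a - 1))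
    (hsmall : θ * L < 1)
    (w : ℝ → ℝ) (hwc : ContinuousOn w (Ici 0)) (hwpos : ∀ t ≥ (0:ℝ), 0 ≤ w t)
    (hineq : ∀ t ≥ (0:ℝ), w t ≤ C * Real.exp (-lam * t) +
      θ * ∫ s in (0:ℝ)..t, (1 + (t - s) ^ (-a)) * Real.exp (-lam * (t - s)) * w s) :
    ∀ t ≥ (0:ℝ), w t ≤ C / (1 - θ * L) * Real.exp (-σ * t) := by
  intro T hT
  obtain ⟨hki, hkv⟩ := kernel_aux a (lam - σ) ha (by linarith)
  rw [← hL] at hkv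
  obtain ⟨t0, ht0, hmax⟩ := (isCompact_Icc (a := (0:ℝ)) (b := T)).exists_isMaxOn
    ⟨0, le_rfl, hT⟩ (f := fun s => w s * Real.exp (σ * s))
    ((hwc.mono (fun x hx => hx.1)).mul (by fun_prop))
  set M := w t0 * Real.exp (σ * t0) with hM
  have hM0 : 0 ≤ M := mul_nonneg (hwpos _ ht0.1) (Real.exp_pos _).le
  have hle : ∀ s ∈ Icc (0:ℝ) T, w s ≤ M * Real.exp (-σ * s) := by
    intro s hs
    have h : w s * Real.exp (σ * s) ≤ M := hmax hs
    calc w s = w s * Real.exp (σ * s) * Real.exp (-σ * s) := by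
          rw [mul_assoc, ← Real.exp_add]; simp
      _ ≤ _ := by gcongr
  set k : ℝ → ℝ := fun x => (1 + x ^ (-a)) * Real.exp (-(lam - σ) * x) with hk
  have hk0 : ∀ x, 0 ≤ x → 0 ≤ k x := fun x hx => by
    have := Real.rpow_nonneg hx (-a)
    simp only [hk]; positivity
  have hkI : IntervalIntegrable k volume 0 t0 := by
    rw [intervalIntegrable_iff_integrableOn_Ioc_of_le ht0.1]
    exact hki.mono_set Ioc_subset_Ioi_self
  have hkint : ∫ x in (0:ℝ)..t0, k x ≤ L := by
    rw [intervalIntegral.integral_of_le ht0.1, ← hkv]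
    refine setIntegral_mono_set hki ?_ Ioc_subset_Ioi_self.eventuallyLE
    filter_upwards [ae_restrict_mem measurableSet_Ioi] with x hx
    exact hk0 x (le_of_lt hx)
  have hkI' : IntervalIntegrable (fun s => k (t0 - s)) volume 0 t0 := by
    have := (hkI.comp_sub_left t0).symm
    simpa using this
  have hint : ∫ s in (0:ℝ)..t0, (1 + (t0 - s) ^ (-a)) * Real.exp (-lam * (t0 - s)) * w s
      ≤ M * Real.exp (-σ * t0) * L := by
    calc _ ≤ ∫ s in (0:ℝ)..t0, M * Real.exp (-σ * t0) * k (t0 - s) := by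
          rw [intervalIntegral.integral_of_le ht0.1, intervalIntegral.integral_of_le ht0.1]
          refine integral_mono_of_nonneg ?_ ?_ ?_
          · filter_upwards [ae_restrict_mem measurableSet_Ioc] with s hs
            have h1 := Real.rpow_nonneg (sub_nonneg.2 hs.2) (-a)
            have h2 := hwpos s hs.1.le
            simp only [Pi.zero_apply]
            positivity
          · exact ((intervalIntegrable_iff_integrableOn_Ioc_of_le ht0.1).1 hkI').const_mul _
          · filter_upwards [ae_restrict_mem measurableSet_Ioc] with s hs
            have h1 := Real.rpow_nonneg (sub_nonneg.2 hs.2) (-a)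
            have h2 := hle s ⟨hs.1.le, hs.2.trans ht0.2⟩
            calc _ ≤ (1 + (t0 - s) ^ (-a)) * Real.exp (-lam * (t0 - s)) *
                  (M * Real.exp (-σ * s)) := by gcongr
              _ = M * (1 + (t0 - s) ^ (-a)) *
                  (Real.exp (-lam * (t0 - s)) * Real.exp (-σ * s)) := by ring
              _ = M * (1 + (t0 - s) ^ (-a)) *
                  (Real.exp (-σ * t0) * Real.exp (-(lam - σ) * (t0 - s))) := by
                  rw [← Real.exp_add, ← Real.exp_add]; congr 2; ring
              _ = _ := by simp only [hk]; ring
      _ = M * Real.exp (-σ * t0) * ∫ x in (0:ℝ)..t0, k x := by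
          rw [intervalIntegral.integral_const_mul, intervalIntegral.integral_comp_sub_left]
          simp
      _ ≤ _ := by gcongr
  have hfin : M ≤ C + θ * L * M := by
    have h := hineq t0 ht0.1
    have h1 : w t0 ≤ C * Real.exp (-σ * t0) + θ * (M * Real.exp (-σ * t0) * L) := by
      refine h.trans ?_
      have : Real.exp (-lam * t0) ≤ Real.exp (-σ * t0) := by
        apply Real.exp_le_exp.2
        nlinarith [ht0.1]
      gcongr
    have h2 : Real.exp (-σ * t0) * Real.exp (σ * t0) = 1 := by
      rw [← Real.exp_add]; simp
    calc M ≤ (C * Real.exp (-σ * t0) + θ * (M * Real.exp (-σ * t0) * L)) *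
          Real.exp (σ * t0) := by rw [hM]; gcongr
      _ = (C + θ * L * M) * (Real.exp (-σ * t0) * Real.exp (σ * t0)) := by ring
      _ = _ := by rw [h2, mul_one]
  have hMle : M ≤ C / (1 - θ * L) := by
    rw [le_div_iff₀ (by linarith)]
    linarith
  exact (hle T ⟨hT, le_rfl⟩).trans (by gcongr)
end
end
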